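/- arXiv:2510.16608 — 9 statements merged into one kernel-verified Lean document; each statement's English description precedes it below -/
import Mathlib

section
/- For every integer N ≥ 1, every t ≥ 0, and all integers K, K' with 0 ≤ K < K' ≤ N, an unsure voter's belief of having the good type is strictly increasing in the number of sure winners: G_N(K, t) < G_N(K', t). -/
open Real Filter

/-- Likelihood ratio ℓ_N(K,t). -/
noncomputable def ell (q0 ρH ρL lam : ℝ) (N K : ℕ) (t : ℝ) : ℝ :=
  (q0 / (1 - q0)) * (ρH / ρL) ^ K *
    ((1 - ρH * (1 - Real.exp (-lam * t))) / (1 - ρL * (1 - Real.exp (-lam * t)))) ^ (N - K)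

/-- Belief of good type conditional on state, P_ρ(t). -/
noncomputable def Pst (ρ lam t : ℝ) : ℝ :=
  ρ * Real.exp (-lam * t) / (ρ * Real.exp (-lam * t) + 1 - ρ)

/-- Posterior probability of state H, Q_N(K,t). -/
noncomputable def Q (q0 ρH ρL lam : ℝ) (N K : ℕ) (t : ℝ) : ℝ :=
  ell q0 ρH ρL lam N K t / (1 + ell q0 ρH ρL lam N K t)

/-- Belief of good type G_N(K,t). -/
noncomputable def G (q0 ρH ρL lam : ℝ) (N K : ℕ) (t : ℝ) : ℝ :=
  Q q0 ρH ρL lam N K t * Pst ρH lam t + (1 - Q q0 ρH ρL lam N K t) * Pst ρL lam t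

theorem pow_mul_pow_sub_lt {a b : ℝ} (hb : 0 < b) (hab : b < a) {N K K' : ℕ}
    (hKK : K < K') (hK'N : K' ≤ N) :
    a ^ K * b ^ (N - K) < a ^ K' * b ^ (N - K') := by
  obtain ⟨d, rfl⟩ := Nat.exists_eq_add_of_lt hKK
  have hsub : N - K = (d + 1) + (N - (K + d + 1)) := by omega
  have hpow : b ^ (d + 1) < a ^ (d + 1) := pow_lt_pow_left₀ hab hb.le (Nat.succ_ne_zero d)
  have ha : 0 < a := hb.trans hab
  rw [hsub, pow_add b, add_assoc K, pow_add a, ← mul_assoc]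
  gcongr

theorem div_one_add_lt_div_one_add {x y : ℝ} (hx : 0 < x) (hxy : x < y) :
    x / (1 + x) < y / (1 + y) := by
  rw [div_lt_div_iff₀ (by linarith) (by linarith)]
  linarith

theorem one_sub_mul_one_sub_pos {ρ e : ℝ} (h0 : 0 < ρ) (h1 : ρ < 1) (he : 0 < e) :
    0 < 1 - ρ * (1 - e) := by
  linarith [mul_pos h0 he]

theorem ell_pos {q0 ρH ρL : ℝ} (hq0 : 0 < q0) (hq1 : q0 < 1) (hρL : 0 < ρL) (hρ : ρL < ρH)
    (hρH : ρH < 1) (lam : ℝ) (N K : ℕ) (t : ℝ) : 0 < ell q0 ρH ρL lam N K t := by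
  have hρH0 : 0 < ρH := hρL.trans hρ
  have hH := one_sub_mul_one_sub_pos hρH0 hρH (Real.exp_pos (-lam * t))
  have hL := one_sub_mul_one_sub_pos hρL (hρ.trans hρH) (Real.exp_pos (-lam * t))
  have hq : 0 < 1 - q0 := sub_pos.2 hq1
  unfold ell
  positivity

theorem ell_lt_ell {q0 ρH ρL lam t : ℝ} (hlam : 0 ≤ lam) (hq0 : 0 < q0) (hq1 : q0 < 1)
    (hρL : 0 < ρL) (hρ : ρL < ρH) (hρH : ρH < 1) (ht : 0 ≤ t) {N K K' : ℕ}
    (hKK : K < K') (hK'N : K' ≤ N) :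
    ell q0 ρH ρL lam N K t < ell q0 ρH ρL lam N K' t := by
  have hH := one_sub_mul_one_sub_pos (hρL.trans hρ) hρH (Real.exp_pos (-lam * t))
  have hL := one_sub_mul_one_sub_pos hρL (hρ.trans hρH) (Real.exp_pos (-lam * t))
  have he : Real.exp (-lam * t) ≤ 1 := Real.exp_le_one_iff.2 (by nlinarith)
  have hb : (1 - ρH * (1 - Real.exp (-lam * t))) / (1 - ρL * (1 - Real.exp (-lam * t))) ≤ 1 := by
    rw [div_le_one hL]
    nlinarith
  have ha : 1 < ρH / ρL := (one_lt_div hρL).2 hρ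
  unfold ell
  rw [mul_assoc, mul_assoc]
  exact mul_lt_mul_of_pos_left
    (pow_mul_pow_sub_lt (div_pos hH hL) (hb.trans_lt ha) hKK hK'N)
    (div_pos hq0 (sub_pos.2 hq1))

theorem Pst_lt_Pst {ρH ρL : ℝ} (hρL : 0 < ρL) (hρ : ρL < ρH) (hρH : ρH < 1) (lam t : ℝ) :
    Pst ρL lam t < Pst ρH lam t := by
  have he := Real.exp_pos (-lam * t)
  unfold Pst
  rw [div_lt_div_iff₀ (by nlinarith) (by nlinarith)]
  nlinarith [mul_pos he (sub_pos.2 hρ)]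

/-- an unsure voter's belief of having the good type is strictly
increasing in the number of sure winners. -/
theorem belief_strictMono_in_winners
    (lam q0 ρH ρL : ℝ) (hlam : 0 < lam) (hq0 : 0 < q0) (hq1 : q0 < 1)
    (hρL : 0 < ρL) (hρ : ρL < ρH) (hρH : ρH < 1)
    (N : ℕ) (hN : 1 ≤ N) (t : ℝ) (ht : 0 ≤ t)
    (K K' : ℕ) (hKK : K < K') (hK'N : K' ≤ N) :
    G q0 ρH ρL lam N K t < G q0 ρH ρL lam N K' t := by
  have hQ : Q q0 ρH ρL lam N K t < Q q0 ρH ρL lam N K' t :=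
    div_one_add_lt_div_one_add (ell_pos hq0 hq1 hρL hρ hρH lam N K t)
      (ell_lt_ell hlam.le hq0 hq1 hρL hρ hρH ht hKK hK'N)
  have hP := Pst_lt_Pst hρL hρ hρH lam t
  unfold G
  linarith [mul_pos (sub_pos.2 hQ) (sub_pos.2 hP)]
end

section
/- (Proposition 1, equilibrium existence and uniqueness.) For all integers N ≥ 1 and M with 1 ≤ M ≤ N, there exists a unique t > 0 such that f_{N,M}(t) = s. -/
open Real Filter

/-- The function f_{N,M}(t). -/
noncomputable def fNM (q0 ρH ρL lam r z s g : ℝ) (N M : ℕ) (t : ℝ) : ℝ :=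
  G q0 ρH ρL lam N (M - 1) t * lam *
    (z + g / r - s / r + ((N : ℝ) - (M : ℝ)) * (G q0 ρH ρL lam N M t * g / r - s / r))

/-- The likelihood ratio as a function of `x = exp (-lam * t)`, with prior factor `c`. -/
noncomputable def likelihoodAt (c a b : ℝ) (n : ℕ) (x : ℝ) : ℝ :=
  c * ((1 - a * (1 - x)) / (1 - b * (1 - x))) ^ n

/-- The probability of a good type as a function of `x = exp (-lam * t)`. -/
noncomputable def goodAt (a x : ℝ) : ℝ := a * x / (a * x + 1 - a)

/-- The belief as a function of `x = exp (-lam * t)`. -/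
noncomputable def beliefAt (c a b : ℝ) (n : ℕ) (x : ℝ) : ℝ :=
  likelihoodAt c a b n x / (1 + likelihoodAt c a b n x) * goodAt a x +
    (1 - likelihoodAt c a b n x / (1 + likelihoodAt c a b n x)) * goodAt b x

theorem G_eq_beliefAt (q0 ρH ρL lam : ℝ) (N K : ℕ) (t : ℝ) :
    G q0 ρH ρL lam N K t =
      beliefAt (q0 / (1 - q0) * (ρH / ρL) ^ K) ρH ρL (N - K) (Real.exp (-lam * t)) :=
  rfl

theorem one_sub_mul_one_sub_pos_s6 {a x : ℝ} (ha : 0 < a) (ha1 : a < 1) (hx : 0 ≤ x) :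
    0 < 1 - a * (1 - x) := by
  nlinarith [mul_nonneg ha.le hx]

theorem likelihoodAt_pos {c a b x : ℝ} (n : ℕ) (hc : 0 < c) (ha : 0 < a) (ha1 : a < 1)
    (hb : 0 < b) (hb1 : b < 1) (hx : 0 ≤ x) : 0 < likelihoodAt c a b n x :=
  mul_pos hc (pow_pos (div_pos (one_sub_mul_one_sub_pos_s6 ha ha1 hx)
    (one_sub_mul_one_sub_pos_s6 hb hb1 hx)) n)

theorem likelihoodAt_monotoneOn {c a b : ℝ} (n : ℕ) (hc : 0 < c) (hb : 0 < b) (hab : b < a)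
    (ha1 : a < 1) : MonotoneOn (likelihoodAt c a b n) (Set.Ici 0) := by
  intro x hx y hy hxy
  have ha : 0 < a := hb.trans hab
  have hb1 : b < 1 := hab.trans ha1
  have hxb := one_sub_mul_one_sub_pos_s6 hb hb1 hx
  have hyb := one_sub_mul_one_sub_pos_s6 hb hb1 hy
  have hxa := one_sub_mul_one_sub_pos_s6 ha ha1 hx
  refine mul_le_mul_of_nonneg_left (pow_le_pow_left₀ (div_pos hxa hxb).le ?_ n) hc.le
  rw [div_le_div_iff₀ hxb hyb]
  nlinarith [mul_nonneg (sub_nonneg.2 hab.le) (sub_nonneg.2 hxy)]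

theorem goodAt_strictMonoOn {a : ℝ} (ha : 0 < a) (ha1 : a < 1) :
    StrictMonoOn (goodAt a) (Set.Ici 0) := by
  intro x hx y hy hxy
  have hxa := one_sub_mul_one_sub_pos_s6 ha ha1 hx
  have hya := one_sub_mul_one_sub_pos_s6 ha ha1 hy
  unfold goodAt
  rw [div_lt_div_iff₀ (by linarith) (by linarith)]
  nlinarith [mul_pos (mul_pos ha (sub_pos.2 ha1)) (sub_pos.2 hxy)]

theorem goodAt_mono_left {a b x : ℝ} (hb : 0 < b) (hab : b < a) (ha1 : a < 1) (hx : 0 ≤ x) :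
    goodAt b x ≤ goodAt a x := by
  have hxa := one_sub_mul_one_sub_pos_s6 (hb.trans hab) ha1 hx
  have hxb := one_sub_mul_one_sub_pos_s6 hb (hab.trans ha1) hx
  unfold goodAt
  rw [div_le_div_iff₀ (by linarith) (by linarith)]
  nlinarith [mul_nonneg (sub_nonneg.2 hab.le) hx]

theorem div_one_add_mono {u v : ℝ} (hu : 0 < u) (huv : u ≤ v) : u / (1 + u) ≤ v / (1 + v) := by
  rw [div_le_div_iff₀ (by linarith) (by linarith)]
  nlinarith

theorem mixture_lt_mixture {p q A B A' B' : ℝ} (hp : 0 < p) (hpq : p ≤ q) (hq : q < 1)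
    (hA : A < A') (hB : B < B') (hBA : B' ≤ A') :
    p * A + (1 - p) * B < q * A' + (1 - q) * B' := by
  nlinarith [mul_pos hp (sub_pos.2 hA), mul_pos (sub_pos.2 (hpq.trans_lt hq)) (sub_pos.2 hB),
    mul_nonneg (sub_nonneg.2 hpq) (sub_nonneg.2 hBA)]

theorem beliefAt_strictMonoOn {c a b : ℝ} (n : ℕ) (hc : 0 < c) (hb : 0 < b) (hab : b < a)
    (ha1 : a < 1) : StrictMonoOn (beliefAt c a b n) (Set.Ici 0) := by
  intro x hx y hy hxy
  have ha : 0 < a := hb.trans hab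
  have hb1 : b < 1 := hab.trans ha1
  have hlx := likelihoodAt_pos n hc ha ha1 hb hb1 hx
  have hly := likelihoodAt_pos n hc ha ha1 hb hb1 hy
  exact mixture_lt_mixture (by positivity)
    (div_one_add_mono hlx (likelihoodAt_monotoneOn n hc hb hab ha1 hx hy hxy.le))
    ((div_lt_one (by linarith)).2 (by linarith))
    (goodAt_strictMonoOn ha ha1 hx hy hxy) (goodAt_strictMonoOn hb hb1 hx hy hxy)
    (goodAt_mono_left hb hab ha1 hy)

theorem likelihoodAt_continuousOn {c a b : ℝ} (n : ℕ) (hb : 0 < b) (hb1 : b < 1) :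
    ContinuousOn (likelihoodAt c a b n) (Set.Ici 0) := by
  unfold likelihoodAt
  refine continuousOn_const.mul (ContinuousOn.pow (ContinuousOn.div (by fun_prop) (by fun_prop)
    fun x hx => (one_sub_mul_one_sub_pos_s6 hb hb1 hx).ne') n)

theorem goodAt_continuousOn {a : ℝ} (ha : 0 < a) (ha1 : a < 1) :
    ContinuousOn (goodAt a) (Set.Ici 0) := by
  refine ContinuousOn.div (by fun_prop) (by fun_prop) fun x hx => ?_
  have := one_sub_mul_one_sub_pos_s6 ha ha1 hx
  linarith

theorem beliefAt_continuousOn {c a b : ℝ} (n : ℕ) (hc : 0 < c) (hb : 0 < b) (hab : b < a)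
    (ha1 : a < 1) : ContinuousOn (beliefAt c a b n) (Set.Ici 0) := by
  have ha : 0 < a := hb.trans hab
  have hb1 : b < 1 := hab.trans ha1
  have hl := likelihoodAt_continuousOn (c := c) (a := a) n hb hb1
  have hq : ContinuousOn
      (fun x => likelihoodAt c a b n x / (1 + likelihoodAt c a b n x)) (Set.Ici 0) :=
    hl.div (continuousOn_const.add hl) fun x hx => by
      have := likelihoodAt_pos n hc ha ha1 hb hb1 hx
      linarith
  exact (hq.mul (goodAt_continuousOn ha ha1)).add
    ((continuousOn_const.sub hq).mul (goodAt_continuousOn hb hb1))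

theorem beliefAt_zero (c a b : ℝ) (n : ℕ) : beliefAt c a b n 0 = 0 := by
  simp [beliefAt, goodAt]

theorem prior_le_beliefAt_one {q c a b : ℝ} (n : ℕ) (hq : 0 < q) (hq1 : q < 1)
    (hc : q / (1 - q) ≤ c) (hab : b ≤ a) : q * a + (1 - q) * b ≤ beliefAt c a b n 1 := by
  have hq' : 0 < q / (1 - q) := div_pos hq (sub_pos.2 hq1)
  have hqc : q ≤ c / (1 + c) := by
    refine le_of_eq_of_le ?_ (div_one_add_mono hq' hc)
    have := (sub_pos.2 hq1).ne'
    field_simp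
    ring
  have h : beliefAt c a b n 1 = c / (1 + c) * a + (1 - c / (1 + c)) * b := by
    simp [beliefAt, likelihoodAt, goodAt]
  rw [h]
  nlinarith [mul_nonneg (sub_nonneg.2 hqc) (sub_nonneg.2 hab)]

theorem existsUnique_mul_eq_of_strictMonoOn {u w : ℝ → ℝ} {s : ℝ}
    (hu : StrictMonoOn u (Set.Icc 0 1)) (hw : MonotoneOn w (Set.Icc 0 1))
    (huc : ContinuousOn u (Set.Icc 0 1)) (hwc : ContinuousOn w (Set.Icc 0 1))
    (hu0 : u 0 = 0) (hs : 0 < s) (hs1 : s < u 1 * w 1) :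
    ∃! x, x ∈ Set.Ioo (0 : ℝ) 1 ∧ u x * w x = s := by
  have hlt : ∀ x ∈ Set.Ioo (0 : ℝ) 1, ∀ y ∈ Set.Ioo (0 : ℝ) 1, u x * w x = s → x < y →
      s < u y * w y := by
    intro x hx y hy hxs hxy
    have hx' := Set.Ioo_subset_Icc_self hx
    have hy' := Set.Ioo_subset_Icc_self hy
    have hux : 0 < u x := hu0 ▸ hu (Set.left_mem_Icc.2 zero_le_one) hx' hx.1
    have hwx : 0 < w x := pos_of_mul_pos_right (hxs ▸ hs) hux.le
    rw [← hxs]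
    exact mul_lt_mul (hu hx' hy' hxy) (hw hx' hy' hxy.le) hwx (hux.trans (hu hx' hy' hxy)).le
  obtain ⟨x, hx, hxs⟩ := intermediate_value_Ioo zero_le_one (huc.mul hwc)
    (show s ∈ Set.Ioo (u 0 * w 0) (u 1 * w 1) from ⟨by simpa [hu0] using hs, hs1⟩)
  refine ⟨x, ⟨hx, hxs⟩, fun y ⟨hy, hys⟩ => ?_⟩
  rcases lt_trichotomy y x with h | h | h
  · exact absurd hxs (hlt y hy x hx hys h).ne'
  · exact h
  · exact absurd hys (hlt x hx y hy hxs h).ne'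

theorem existsUnique_exp_neg_mul {lam : ℝ} (hlam : 0 < lam) {p : ℝ → Prop}
    (h : ∃! x, x ∈ Set.Ioo (0 : ℝ) 1 ∧ p x) : ∃! t, 0 < t ∧ p (Real.exp (-lam * t)) := by
  obtain ⟨x, ⟨hx, hpx⟩, huniq⟩ := h
  refine ⟨-Real.log x / lam, ⟨div_pos (neg_pos.2 (Real.log_neg hx.1 hx.2)) hlam, ?_⟩, ?_⟩
  · have : -lam * (-Real.log x / lam) = Real.log x := by field_simp
    rwa [this, Real.exp_log hx.1]
  · rintro t ⟨ht, hpt⟩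
    have hmem : Real.exp (-lam * t) ∈ Set.Ioo (0 : ℝ) 1 :=
      ⟨Real.exp_pos _, Real.exp_lt_one_iff.2 (by nlinarith)⟩
    rw [← huniq _ ⟨hmem, hpt⟩, Real.log_exp]
    field_simp

/-- Proposition 1: for all N ≥ 1 and 1 ≤ M ≤ N, there exists a
unique t > 0 with f_{N,M}(t) = s. -/
theorem equilibrium_exists_unique
    (lam q0 ρH ρL r z s g : ℝ) (hlam : 0 < lam) (hq0 : 0 < q0) (hq1 : q0 < 1)
    (hρL : 0 < ρL) (hρ : ρL < ρH) (hρH : ρH < 1)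
    (hr : 0 < r) (hz : 0 < z) (hs : 0 < s) (hg : g = lam * z)
    (hgs : ρH * g > s) (hsg : s > ρL * g)
    (hprior : q0 * ρH * g + (1 - q0) * ρL * g > s)
    (N M : ℕ) (hN : 1 ≤ N) (hM1 : 1 ≤ M) (hMN : M ≤ N) :
    ∃! t : ℝ, 0 < t ∧ fNM q0 ρH ρL lam r z s g N M t = s := by
  have hgpos : 0 < g := hg ▸ mul_pos hlam hz
  have hsg' : s < g := hgs.trans (by nlinarith)
  have hNM : (0 : ℝ) ≤ (N : ℝ) - M := sub_nonneg.2 (Nat.cast_le.2 hMN)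
  have hodds : 0 < q0 / (1 - q0) := div_pos hq0 (sub_pos.2 hq1)
  have hfactor : ∀ K : ℕ, q0 / (1 - q0) ≤ q0 / (1 - q0) * (ρH / ρL) ^ K := fun K =>
    le_mul_of_one_le_right hodds.le (one_le_pow₀ ((one_le_div hρL).2 hρ.le))
  let u (K : ℕ) := beliefAt (q0 / (1 - q0) * (ρH / ρL) ^ K) ρH ρL (N - K)
  have hmono : ∀ K, StrictMonoOn (u K) (Set.Icc 0 1) := fun K =>
    (beliefAt_strictMonoOn _ (hodds.trans_le (hfactor K)) hρL hρ hρH).mono Set.Icc_subset_Ici_self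
  have hcont : ∀ K, ContinuousOn (u K) (Set.Icc 0 1) := fun K =>
    (beliefAt_continuousOn _ (hodds.trans_le (hfactor K)) hρL hρ hρH).mono Set.Icc_subset_Ici_self
  have hone : ∀ K, s < u K 1 * g := fun K => by
    have := mul_le_mul_of_nonneg_right
      (prior_le_beliefAt_one (N - K) hq0 hq1 (hfactor K) hρ.le) hgpos.le
    refine lt_of_lt_of_le ?_ this
    linarith
  let w (x : ℝ) := z + g / r - s / r + ((N : ℝ) - M) * (u M x * g / r - s / r)
  have hw : MonotoneOn w (Set.Icc 0 1) := fun x hx y hy hxy => by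
    have := (hmono M).monotoneOn hx hy hxy
    dsimp only [w]
    gcongr
  have hwc : ContinuousOn w (Set.Icc 0 1) :=
    continuousOn_const.add (continuousOn_const.mul
      ((((hcont M).mul continuousOn_const).div_const r).sub continuousOn_const))
  have hw1 : z ≤ w 1 := by
    have h1 : s / r ≤ g / r := by gcongr
    have h2 : s / r ≤ u M 1 * g / r := by have := (hone M).le; gcongr
    have := mul_nonneg hNM (sub_nonneg.2 h2)
    dsimp only [w]
    linarith
  simp only [fNM, G_eq_beliefAt]
  refine existsUnique_exp_neg_mul hlam (p := fun x => u (M - 1) x * lam * w x = s)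
    (existsUnique_mul_eq_of_strictMonoOn (u := fun x => u (M - 1) x * lam)
      (fun x hx y hy hxy => mul_lt_mul_of_pos_right (hmono (M - 1) hx hy hxy) hlam) hw
      ((hcont (M - 1)).mul continuousOn_const) hwc ?_ hs ?_)
  · simp [u, beliefAt_zero]
  · have h := hone (M - 1)
    have hpos : 0 < u (M - 1) 1 := pos_of_mul_pos_left (hs.trans h) hgpos.le
    calc s < u (M - 1) 1 * lam * z := by rwa [mul_assoc, ← hg]
      _ ≤ u (M - 1) 1 * lam * w 1 := by gcongr
end

section
/- For all integers N ≥ 1 and M with 1 ≤ M ≤ N, the limit of f_{N,M}(t) as t → 0+ is strictly greater than s. -/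
open Real Filter

theorem ell_zero (q0 ρH ρL lam : ℝ) (N K : ℕ) :
    ell q0 ρH ρL lam N K 0 = q0 / (1 - q0) * (ρH / ρL) ^ K := by
  simp [ell]

theorem Pst_zero (ρ lam : ℝ) : Pst ρ lam 0 = ρ := by
  simp [Pst]

theorem ell_zero_pos {q0 ρH ρL : ℝ} (hq0 : 0 < q0) (hq1 : q0 < 1) (hρL : 0 < ρL)
    (hρH : 0 < ρH) (lam : ℝ) (N K : ℕ) : 0 < ell q0 ρH ρL lam N K 0 := by
  have := sub_pos.2 hq1
  rw [ell_zero]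
  positivity

theorem le_Q_zero {q0 ρH ρL : ℝ} (hq0 : 0 < q0) (hq1 : q0 < 1) (hρL : 0 < ρL)
    (hρ : ρL ≤ ρH) (lam : ℝ) (N K : ℕ) : q0 ≤ Q q0 ρH ρL lam N K 0 := by
  have hpos := ell_zero_pos hq0 hq1 hρL (hρL.trans_le hρ) lam N K
  have h1q := sub_pos.2 hq1
  have hpow : 1 ≤ (ρH / ρL) ^ K := one_le_pow₀ ((one_le_div hρL).2 hρ)
  have hle : q0 / (1 - q0) ≤ ell q0 ρH ρL lam N K 0 := by
    rw [ell_zero]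
    exact le_mul_of_one_le_right (div_pos hq0 h1q).le hpow
  rw [div_le_iff₀ h1q] at hle
  rw [Q, le_div_iff₀ (by linarith)]
  linarith

theorem le_G_zero {q0 ρH ρL : ℝ} (hq0 : 0 < q0) (hq1 : q0 < 1) (hρL : 0 < ρL)
    (hρ : ρL ≤ ρH) (lam : ℝ) (N K : ℕ) :
    q0 * ρH + (1 - q0) * ρL ≤ G q0 ρH ρL lam N K 0 := by
  have hQ := le_Q_zero hq0 hq1 hρL hρ lam N K
  rw [G, Pst_zero, Pst_zero]
  linarith [mul_nonneg (sub_nonneg.2 hQ) (sub_nonneg.2 hρ)]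

theorem continuousAt_ell_zero (q0 ρH ρL lam : ℝ) (N K : ℕ) :
    ContinuousAt (ell q0 ρH ρL lam N K) 0 := by
  unfold ell
  refine ContinuousAt.mul (by fun_prop) (ContinuousAt.pow ?_ _)
  exact ContinuousAt.div (by fun_prop) (by fun_prop) (by simp)

theorem continuousAt_Pst_zero (ρ lam : ℝ) : ContinuousAt (Pst ρ lam) 0 := by
  unfold Pst
  exact ContinuousAt.div (by fun_prop) (by fun_prop) (by simp)

theorem continuousAt_G_zero {q0 ρH ρL : ℝ} (hq0 : 0 < q0) (hq1 : q0 < 1) (hρL : 0 < ρL)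
    (hρH : 0 < ρH) (lam : ℝ) (N K : ℕ) : ContinuousAt (G q0 ρH ρL lam N K) 0 := by
  have hell := continuousAt_ell_zero q0 ρH ρL lam N K
  have hpos := ell_zero_pos hq0 hq1 hρL hρH lam N K
  have hQ : ContinuousAt (Q q0 ρH ρL lam N K) 0 :=
    hell.div (continuousAt_const.add hell) (by positivity)
  exact (hQ.mul (continuousAt_Pst_zero ρH lam)).add
    ((continuousAt_const.sub hQ).mul (continuousAt_Pst_zero ρL lam))

/-- the limit of f_{N,M}(t) as t → 0+ is strictly greater than s. -/
theorem f_limit_at_zero_gt_s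
    (lam q0 ρH ρL r z s g : ℝ) (hlam : 0 < lam) (hq0 : 0 < q0) (hq1 : q0 < 1)
    (hρL : 0 < ρL) (hρ : ρL < ρH) (hρH : ρH < 1)
    (hr : 0 < r) (hz : 0 < z) (hs : 0 < s) (hg : g = lam * z)
    (hgs : ρH * g > s) (hsg : s > ρL * g)
    (hprior : q0 * ρH * g + (1 - q0) * ρL * g > s)
    (N M : ℕ) (hN : 1 ≤ N) (hM1 : 1 ≤ M) (hMN : M ≤ N) :
    ∃ L : ℝ, s < L ∧
      Tendsto (fun t => fNM q0 ρH ρL lam r z s g N M t)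
        (nhdsWithin 0 (Set.Ioi 0)) (nhds L) := by
  have hG := fun K => continuousAt_G_zero hq0 hq1 hρL (hρL.trans hρ) lam N K
  refine ⟨fNM q0 ρH ρL lam r z s g N M 0, ?_, ?_⟩
  · have hgpos : 0 < g := hg ▸ mul_pos hlam hz
    have hsltG : ∀ K, s < G q0 ρH ρL lam N K 0 * g := fun K => by
      have := mul_le_mul_of_nonneg_right (le_G_zero hq0 hq1 hρL hρ.le lam N K) hgpos.le
      linarith
    have hGpos : 0 < G q0 ρH ρL lam N (M - 1) 0 :=
      pos_of_mul_pos_left (hs.trans (hsltG _)) hgpos.le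
    have hsg' : s < g := hgs.trans (mul_lt_of_lt_one_left hgpos hρH)
    have hflow : 0 < g / r - s / r := sub_pos.2 (div_lt_div_of_pos_right hsg' hr)
    have hothers :
        0 ≤ ((N : ℝ) - (M : ℝ)) * (G q0 ρH ρL lam N M 0 * g / r - s / r) :=
      mul_nonneg (sub_nonneg.2 (by exact_mod_cast hMN))
        (sub_nonneg.2 (div_le_div_of_nonneg_right (hsltG M).le hr.le))
    calc s < G q0 ρH ρL lam N (M - 1) 0 * lam * z := by
          rw [mul_assoc, ← hg]
          exact hsltG _
      _ ≤ fNM q0 ρH ρL lam r z s g N M 0 :=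
          mul_le_mul_of_nonneg_left (by linarith) (mul_pos hGpos hlam).le
  · have hcont : ContinuousAt (fNM q0 ρH ρL lam r z s g N M) 0 := by
      have h1 := hG (M - 1)
      have h2 := hG M
      unfold fNM
      fun_prop
    exact hcont.tendsto.mono_left nhdsWithin_le_nhds
end

section
/- For every k with k̂ ≤ k < 1 and every t ≥ 0, we have φ_k(t) > 1. -/
open Real Filter

/-- The function φ_k(t). -/
noncomputable def phi (ρH ρL lam k t : ℝ) : ℝ :=
  (ρH / ρL) ^ k *
    ((1 - ρH * (1 - Real.exp (-lam * t))) / (1 - ρL * (1 - Real.exp (-lam * t)))) ^ (1 - k)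

/-- The threshold k̂. -/
noncomputable def khat (ρH ρL : ℝ) : ℝ :=
  Real.log ((1 - ρL) / (1 - ρH)) /
    (Real.log (ρH / ρL) + Real.log ((1 - ρL) / (1 - ρH)))

/-- for every k with k̂ ≤ k < 1 and every t ≥ 0, φ_k(t) > 1. -/
theorem phi_gt_one_of_khat_le
    (lam ρH ρL : ℝ) (hlam : 0 < lam)
    (hρL : 0 < ρL) (hρ : ρL < ρH) (hρH : ρH < 1)
    (k : ℝ) (hk1 : khat ρH ρL ≤ k) (hk2 : k < 1) (t : ℝ) (ht : 0 ≤ t) :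
    1 < phi ρH ρL lam k t := by
  have hρH0 : 0 < ρH := hρL.trans hρ
  have hu1 : 1 - Real.exp (-lam * t) < 1 := by linarith [Real.exp_pos (-lam * t)]
  have hu0 : 0 ≤ 1 - Real.exp (-lam * t) := by
    have : Real.exp (-lam * t) ≤ 1 := Real.exp_le_one_iff.mpr (by nlinarith)
    linarith
  unfold phi
  unfold khat at hk1
  generalize 1 - Real.exp (-lam * t) = u at hu0 hu1 ⊢
  have hH : 0 < 1 - ρH := by linarith
  have hL : 0 < 1 - ρL := by linarith
  have hHu : 0 < 1 - ρH * u := by nlinarith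
  have hLu : 0 < 1 - ρL * u := by nlinarith
  have ha : 0 < Real.log (ρH / ρL) := Real.log_pos ((one_lt_div hρL).mpr hρ)
  have hb : 0 < Real.log ((1 - ρL) / (1 - ρH)) :=
    Real.log_pos ((one_lt_div hH).mpr (by linarith))
  have hq : -Real.log ((1 - ρL) / (1 - ρH)) < Real.log ((1 - ρH * u) / (1 - ρL * u)) := by
    rw [← Real.log_inv, inv_div]
    refine Real.log_lt_log (div_pos hH hL) ?_
    rw [div_lt_div_iff₀ hL hLu]
    nlinarith [mul_pos (sub_pos.mpr hρ) (sub_pos.mpr hu1)]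
  rw [div_le_iff₀ (add_pos ha hb)] at hk1
  have hqpos : 0 < (1 - ρH * u) / (1 - ρL * u) := div_pos hHu hLu
  have hapos : 0 < ρH / ρL := div_pos hρH0 hρL
  rw [Real.rpow_def_of_pos hapos, Real.rpow_def_of_pos hqpos, ← Real.exp_add, Real.one_lt_exp_iff]
  nlinarith [mul_pos (sub_pos.mpr hk2) (sub_pos.mpr hq)]
end

section
/- For every k ∈ (0, k̂) there exists a unique t > 0 such that φ_k(t) = 1. -/
open Real Filter

/-- The threshold `khat` lies below `1`. -/
lemma khat_lt_one {ρH ρL : ℝ} (hρL : 0 < ρL) (hρ : ρL < ρH) (hρH : ρH < 1) :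
    khat ρH ρL < 1 := by
  have ha : 0 < Real.log (ρH / ρL) := Real.log_pos ((one_lt_div hρL).2 hρ)
  have hb : 0 < Real.log ((1 - ρL) / (1 - ρH)) :=
    Real.log_pos ((one_lt_div (by linarith)).2 (by linarith))
  rw [khat, div_lt_one (by linarith)]
  linarith

/-- Below the threshold, the limiting value of `phi` at infinity is less than `1`. -/
lemma rpow_mul_rpow_lt_one_of_lt_khat {ρH ρL k : ℝ} (hρL : 0 < ρL) (hρ : ρL < ρH)
    (hρH : ρH < 1) (hk : k < khat ρH ρL) :
    (ρH / ρL) ^ k * ((1 - ρH) / (1 - ρL)) ^ (1 - k) < 1 := by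
  have ha : 0 < Real.log (ρH / ρL) := Real.log_pos ((one_lt_div hρL).2 hρ)
  have hb : 0 < Real.log ((1 - ρL) / (1 - ρH)) :=
    Real.log_pos ((one_lt_div (by linarith)).2 (by linarith))
  rw [khat, lt_div_iff₀ (by linarith)] at hk
  have hlog : Real.log ((1 - ρH) / (1 - ρL)) = -Real.log ((1 - ρL) / (1 - ρH)) := by
    rw [← Real.log_inv, inv_div]
  rw [Real.rpow_def_of_pos (div_pos (hρL.trans hρ) hρL),
    Real.rpow_def_of_pos (div_pos (by linarith) (by linarith)), ← Real.exp_add,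
    Real.exp_lt_one_iff, hlog]
  linarith

lemma one_sub_mul_one_sub_exp_pos {ρ x : ℝ} (hρ : 0 < ρ) (hρ1 : ρ < 1) :
    0 < 1 - ρ * (1 - Real.exp x) := by
  nlinarith [mul_pos hρ (Real.exp_pos x)]

lemma continuous_phi {ρH ρL : ℝ} (lam k : ℝ) (hρL : 0 < ρL) (hρ : ρL < ρH) (hρH : ρH < 1) :
    Continuous (phi ρH ρL lam k) := by
  unfold phi
  refine continuous_const.mul (Continuous.rpow_const (Continuous.div (by fun_prop) (by fun_prop)
    fun t => (one_sub_mul_one_sub_exp_pos hρL (hρ.trans hρH)).ne') fun t => Or.inl ?_)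
  exact (div_pos (one_sub_mul_one_sub_exp_pos (hρL.trans hρ) hρH)
    (one_sub_mul_one_sub_exp_pos hρL (hρ.trans hρH))).ne'

lemma strictAnti_phi {lam ρH ρL k : ℝ} (hlam : 0 < lam) (hρL : 0 < ρL) (hρ : ρL < ρH)
    (hρH : ρH < 1) (hk : k < 1) : StrictAnti (phi ρH ρL lam k) := by
  intro s t hst
  have hexp : Real.exp (-lam * t) < Real.exp (-lam * s) := Real.exp_lt_exp.2 (by nlinarith)
  have hH (x : ℝ) := one_sub_mul_one_sub_exp_pos (x := x) (hρL.trans hρ) hρH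
  have hL (x : ℝ) := one_sub_mul_one_sub_exp_pos (x := x) hρL (hρ.trans hρH)
  refine mul_lt_mul_of_pos_left (Real.rpow_lt_rpow (div_pos (hH _) (hL _)).le ?_ (by linarith))
    (Real.rpow_pos_of_pos (div_pos (hρL.trans hρ) hρL) k)
  rw [div_lt_div_iff₀ (hL _) (hL _)]
  nlinarith [mul_pos (sub_pos.2 hρ) (sub_pos.2 hexp)]

lemma one_lt_phi_zero {ρH ρL k : ℝ} (lam : ℝ) (hρL : 0 < ρL) (hρ : ρL < ρH) (hk : 0 < k) :
    1 < phi ρH ρL lam k 0 := by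
  simpa [phi] using Real.one_lt_rpow ((one_lt_div hρL).2 hρ) hk

lemma tendsto_phi_atTop {lam ρH ρL : ℝ} (k : ℝ) (hlam : 0 < lam)
    (hρ : ρL < ρH) (hρH : ρH < 1) :
    Tendsto (phi ρH ρL lam k) atTop
      (nhds ((ρH / ρL) ^ k * ((1 - ρH) / (1 - ρL)) ^ (1 - k))) := by
  have hexp : Tendsto (fun t : ℝ => Real.exp (-lam * t)) atTop (nhds 0) :=
    Real.tendsto_exp_atBot.comp (tendsto_id.const_mul_atTop_of_neg (neg_lt_zero.2 hlam))
  have hlin (ρ : ℝ) :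
      Tendsto (fun t : ℝ => 1 - ρ * (1 - Real.exp (-lam * t))) atTop (nhds (1 - ρ)) := by
    simpa using ((hexp.const_sub 1).const_mul ρ).const_sub 1
  have hH : 0 < 1 - ρH := by linarith
  have hL : 0 < 1 - ρL := by linarith
  exact (((hlin ρH).div (hlin ρL) hL.ne').rpow_const (Or.inl (div_pos hH hL).ne')).const_mul _

/-- for every k ∈ (0, k̂) there is a unique t > 0 with φ_k(t) = 1. -/
theorem phi_eq_one_exists_unique
    (lam ρH ρL : ℝ) (hlam : 0 < lam)
    (hρL : 0 < ρL) (hρ : ρL < ρH) (hρH : ρH < 1)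
    (k : ℝ) (hk0 : 0 < k) (hk : k < khat ρH ρL) :
    ∃! t : ℝ, 0 < t ∧ phi ρH ρL lam k t = 1 := by
  have hanti := strictAnti_phi hlam hρL hρ hρH (hk.trans (khat_lt_one hρL hρ hρH))
  have h0 := one_lt_phi_zero lam hρL hρ hk0
  obtain ⟨T, hT⟩ := ((tendsto_phi_atTop k hlam hρ hρH).eventually_lt_const
    (rpow_mul_rpow_lt_one_of_lt_khat hρL hρ hρH hk)).exists
  obtain ⟨t, ht⟩ := mem_range_of_exists_le_of_exists_ge (continuous_phi lam k hρL hρ hρH)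
    ⟨T, hT.le⟩ ⟨0, h0.le⟩
  refine ⟨t, ⟨hanti.lt_iff_gt.1 (ht ▸ h0), ht⟩, ?_⟩
  rintro s ⟨-, hs⟩
  exact hanti.injective (hs.trans ht.symm)
end

section
/- The map k ↦ t̂'_k is strictly increasing on (0, k̂); moreover t̂'_k → 0 as k → 0+ and t̂'_k → ∞ as k → k̂−. -/
open Real Filter

/-- Minus the logarithm of the time-dependent ratio in `phi`. -/
noncomputable def logRatio (ρH ρL lam t : ℝ) : ℝ :=
  Real.log ((1 - ρL * (1 - Real.exp (-lam * t))) / (1 - ρH * (1 - Real.exp (-lam * t))))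

/-- The value of `k` at which `t` solves `phi ρH ρL lam k t = 1`. -/
noncomputable def cutoffInv (ρH ρL lam t : ℝ) : ℝ :=
  logRatio ρH ρL lam t / (Real.log (ρH / ρL) + logRatio ρH ρL lam t)

theorem one_sub_mul_pos {ρ u : ℝ} (hρ0 : 0 < ρ) (hρ1 : ρ < 1) (hu : u ≤ 1) :
    0 < 1 - ρ * u := by
  nlinarith [mul_le_mul_of_nonneg_left hu hρ0.le]

theorem log_one_sub_div_lt {ρH ρL u v : ℝ} (hρL : 0 < ρL) (hρ : ρL < ρH) (hρH : ρH < 1)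
    (huv : u < v) (hv : v ≤ 1) :
    Real.log ((1 - ρL * u) / (1 - ρH * u)) < Real.log ((1 - ρL * v) / (1 - ρH * v)) := by
  have hHu := one_sub_mul_pos (hρL.trans hρ) hρH (huv.le.trans hv)
  have hHv := one_sub_mul_pos (hρL.trans hρ) hρH hv
  have hLu := one_sub_mul_pos hρL (hρ.trans hρH) (huv.le.trans hv)
  apply Real.log_lt_log (by positivity)
  rw [div_lt_div_iff₀ hHu hHv]
  nlinarith [mul_pos (sub_pos.2 hρ) (sub_pos.2 huv)]

theorem div_add_self_lt {a x y : ℝ} (ha : 0 < a) (hx : 0 ≤ x) (hxy : x < y) :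
    x / (a + x) < y / (a + y) := by
  rw [div_lt_div_iff₀ (by linarith) (by linarith)]
  nlinarith

theorem log_ratio_pos {ρH ρL : ℝ} (hρL : 0 < ρL) (hρ : ρL < ρH) : 0 < Real.log (ρH / ρL) :=
  Real.log_pos ((one_lt_div hρL).2 hρ)

theorem logRatio_zero (ρH ρL lam : ℝ) : logRatio ρH ρL lam 0 = 0 := by
  simp [logRatio]

theorem logRatio_strictMono {ρH ρL lam : ℝ} (hlam : 0 < lam) (hρL : 0 < ρL) (hρ : ρL < ρH)
    (hρH : ρH < 1) : StrictMono (logRatio ρH ρL lam) := by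
  intro s t hst
  refine log_one_sub_div_lt hρL hρ hρH ?_ (by linarith [Real.exp_pos (-lam * t)])
  have : Real.exp (-lam * t) < Real.exp (-lam * s) := Real.exp_lt_exp.2 (by nlinarith)
  linarith

theorem logRatio_nonneg {ρH ρL lam t : ℝ} (hlam : 0 < lam) (hρL : 0 < ρL) (hρ : ρL < ρH)
    (hρH : ρH < 1) (ht : 0 ≤ t) : 0 ≤ logRatio ρH ρL lam t :=
  logRatio_zero ρH ρL lam ▸ (logRatio_strictMono hlam hρL hρ hρH).monotone ht

theorem cutoffInv_zero (ρH ρL lam : ℝ) : cutoffInv ρH ρL lam 0 = 0 := by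
  simp [cutoffInv, logRatio_zero]

theorem cutoffInv_strictMonoOn {ρH ρL lam : ℝ} (hlam : 0 < lam) (hρL : 0 < ρL) (hρ : ρL < ρH)
    (hρH : ρH < 1) : StrictMonoOn (cutoffInv ρH ρL lam) (Set.Ici 0) := fun _ hs _ _ hst =>
  div_add_self_lt (log_ratio_pos hρL hρ) (logRatio_nonneg hlam hρL hρ hρH hs)
    (logRatio_strictMono hlam hρL hρ hρH hst)

theorem cutoffInv_lt_khat {ρH ρL lam t : ℝ} (hlam : 0 < lam) (hρL : 0 < ρL) (hρ : ρL < ρH)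
    (hρH : ρH < 1) (ht : 0 ≤ t) : cutoffInv ρH ρL lam t < khat ρH ρL := by
  refine div_add_self_lt (log_ratio_pos hρL hρ) (logRatio_nonneg hlam hρL hρ hρH ht) ?_
  simpa [logRatio] using log_one_sub_div_lt (u := 1 - Real.exp (-lam * t)) (v := 1) hρL hρ hρH
    (by linarith [Real.exp_pos (-lam * t)]) le_rfl

theorem khat_pos {ρH ρL : ℝ} (hρL : 0 < ρL) (hρ : ρL < ρH) (hρH : ρH < 1) :
    0 < khat ρH ρL :=
  cutoffInv_zero ρH ρL 1 ▸ cutoffInv_lt_khat one_pos hρL hρ hρH le_rfl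

theorem cutoffInv_eq_of_phi_eq_one {ρH ρL lam k t : ℝ} (hlam : 0 < lam) (hρL : 0 < ρL)
    (hρ : ρL < ρH) (hρH : ρH < 1) (ht : 0 ≤ t) (h : phi ρH ρL lam k t = 1) :
    cutoffInv ρH ρL lam t = k := by
  have hu : 1 - Real.exp (-lam * t) ≤ 1 := by linarith [Real.exp_pos (-lam * t)]
  have hH := one_sub_mul_pos (hρL.trans hρ) hρH hu
  have hL := one_sub_mul_pos hρL (hρ.trans hρH) hu
  have hR : 0 < ρH / ρL := div_pos (hρL.trans hρ) hρL
  have hlog := congrArg Real.log h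
  rw [phi, Real.log_mul (Real.rpow_pos_of_pos hR _).ne'
    (Real.rpow_pos_of_pos (div_pos hH hL) _).ne', Real.log_rpow hR,
    Real.log_rpow (div_pos hH hL), Real.log_one,
    ← inv_div (1 - ρL * _), Real.log_inv, ← logRatio] at hlog
  have hA := log_ratio_pos hρL hρ
  have hg := logRatio_nonneg hlam hρL hρ hρH ht
  rw [cutoffInv, div_eq_iff (by positivity)]
  linarith

/-- the map k ↦ t̂'_k (the unique positive solution of φ_k(t) = 1)
is strictly increasing on (0, k̂), tends to 0 as k → 0+, and to ∞ as k → k̂−. -/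
theorem cutoff_strictMono_and_limits
    (lam ρH ρL : ℝ) (hlam : 0 < lam)
    (hρL : 0 < ρL) (hρ : ρL < ρH) (hρH : ρH < 1)
    (tc : ℝ → ℝ)
    (htc : ∀ k, 0 < k → k < khat ρH ρL → 0 < tc k ∧ phi ρH ρL lam k (tc k) = 1) :
    StrictMonoOn tc (Set.Ioo 0 (khat ρH ρL)) ∧
    Tendsto tc (nhdsWithin 0 (Set.Ioi 0)) (nhds 0) ∧
    Tendsto tc (nhdsWithin (khat ρH ρL) (Set.Iio (khat ρH ρL))) atTop := by
  have hmono := cutoffInv_strictMonoOn hlam hρL hρ hρH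
  have hinv : ∀ k ∈ Set.Ioo 0 (khat ρH ρL), cutoffInv ρH ρL lam (tc k) = k := fun k hk =>
    cutoffInv_eq_of_phi_eq_one hlam hρL hρ hρH (htc k hk.1 hk.2).1.le (htc k hk.1 hk.2).2
  have hmem : ∀ k ∈ Set.Ioo 0 (khat ρH ρL), tc k ∈ Set.Ici 0 := fun k hk =>
    (htc k hk.1 hk.2).1.le
  have hk0 := khat_pos hρL hρ hρH
  refine ⟨fun j hj k hk hjk => ?_, ?_, ?_⟩
  · rwa [← hmono.lt_iff_lt (hmem j hj) (hmem k hk), hinv j hj, hinv k hk]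
  · refine tendsto_order.2 ⟨fun a ha => ?_, fun ε hε => ?_⟩
    · filter_upwards [Ioo_mem_nhdsGT hk0] with k hk
      exact ha.trans (htc k hk.1 hk.2).1
    · have hpos : 0 < cutoffInv ρH ρL lam ε :=
        cutoffInv_zero ρH ρL lam ▸ hmono Set.self_mem_Ici hε.le hε
      filter_upwards [Ioo_mem_nhdsGT hk0, Ioo_mem_nhdsGT hpos] with k hk hkε
      rw [← hmono.lt_iff_lt (hmem k hk) hε.le, hinv k hk]
      exact hkε.2
  · refine tendsto_atTop.2 fun b => ?_
    have hlt : cutoffInv ρH ρL lam (max b 0) < khat ρH ρL :=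
      cutoffInv_lt_khat hlam hρL hρ hρH (le_max_right b 0)
    filter_upwards [Ioo_mem_nhdsLT hk0, Ioo_mem_nhdsLT hlt] with k hk hkb
    refine (le_max_left b 0).trans (le_of_lt ?_)
    rw [← hmono.lt_iff_lt (le_max_right b 0) (hmem k hk), hinv k hk]
    exact hkb.1
end

section
/- There exists a unique k̄ ∈ (0, k̂) such that φ_{k̄}(t̄) = 1 (equivalently, such that t̂'_{k̄} = t̄). -/
open Real Filter

/-- `a ^ k * b⁻¹ ^ (1 - k) = 1` is a linear equation in `k` after taking logarithms. -/
theorem rpow_mul_rpow_one_sub_eq_one_iff {a b : ℝ} (ha : 1 < a) (hb : 1 < b) (k : ℝ) :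
    a ^ k * b⁻¹ ^ (1 - k) = 1 ↔ k = Real.log b / (Real.log a + Real.log b) := by
  have ha' : 0 < a := by linarith
  have hb' : 0 < b⁻¹ := inv_pos.2 (by linarith)
  have hla := Real.log_pos ha
  have hlb := Real.log_pos hb
  rw [Real.rpow_def_of_pos ha', Real.rpow_def_of_pos hb', ← Real.exp_add, Real.exp_eq_one_iff,
    Real.log_inv, eq_div_iff (by positivity)]
  constructor <;> intro h <;> linarith

theorem div_add_self_lt_div_add_self {a b c : ℝ} (ha : 0 < a) (hb : 0 < b) (hbc : b < c) :
    b / (a + b) < c / (a + c) := by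
  rw [div_lt_div_iff₀ (by linarith) (by linarith)]
  nlinarith

/-- there exists a unique k̄ ∈ (0, k̂) with φ_{k̄}(t̄) = 1, where t̄
is the unique positive solution of P_H(t̄) = s/g. -/
theorem kbar_exists_unique
    (lam ρH ρL s g : ℝ) (hlam : 0 < lam)
    (hρL : 0 < ρL) (hρ : ρL < ρH) (hρH : ρH < 1)
    (hs : 0 < s) (hg : 0 < g) (hgs : ρH * g > s)
    (tbar : ℝ) (htbar : 0 < tbar ∧ Pst ρH lam tbar = s / g) :
    ∃! k : ℝ, (0 < k ∧ k < khat ρH ρL) ∧ phi ρH ρL lam k tbar = 1 := by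
  have hx0 := Real.exp_pos (-lam * tbar)
  have hx1 : Real.exp (-lam * tbar) < 1 := Real.exp_lt_one_iff.2 (by nlinarith [htbar.1])
  unfold phi khat
  generalize Real.exp (-lam * tbar) = x at hx0 hx1
  have hH : 0 < 1 - ρH * (1 - x) := by nlinarith
  have ha : 1 < ρH / ρL := (one_lt_div hρL).2 hρ
  have hb : 1 < (1 - ρL * (1 - x)) / (1 - ρH * (1 - x)) := (one_lt_div hH).2 (by nlinarith)
  have hbc : (1 - ρL * (1 - x)) / (1 - ρH * (1 - x)) < (1 - ρL) / (1 - ρH) := by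
    rw [div_lt_div_iff₀ hH (by linarith)]
    nlinarith [mul_pos (sub_pos.2 hρ) hx0]
  have hla := Real.log_pos ha
  have hlb := Real.log_pos hb
  simp only [← inv_div (1 - ρL * (1 - x)), rpow_mul_rpow_one_sub_eq_one_iff ha hb]
  exact ⟨_, ⟨⟨by positivity, div_add_self_lt_div_add_self hla hlb
    (Real.log_lt_log (by linarith) hbc)⟩, rfl⟩, fun _ h => h.2⟩
end

section
/- (Proposition 3, limit vote-share form.) Set k* = (ρ_H·g − s)/(g − s), and for k ∈ (0,1] define the limit cut-off t̂_k by t̂_k = t̂'_k if 0 < k < k̄ and t̂_k = t̄ if k̄ ≤ k ≤ 1. Then: (i) k̄ < k* < 1; (ii) for every k ∈ (0, k*), ρ_H·(1 − e^{−λt̂_k}) > k > ρ_L·(1 − e^{−λt̂_k}); and (iii) for every k ∈ [k*, 1], ρ_H·(1 − e^{−λt̂_k}) ≤ k and ρ_L·(1 − e^{−λt̂_k}) < k. -/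
open Real Filter

/-- If the tilted product of likelihood ratios of two Bernoulli parameters `b < a` with weight `k`
equals one, then `k` lies strictly between `b` and `a`. -/
theorem mem_Ioo_of_rpow_mul_rpow_eq_one {a b k : ℝ} (hb : 0 < b) (hba : b < a) (ha : a < 1)
    (h : (a / b) ^ k * ((1 - a) / (1 - b)) ^ (1 - k) = 1) : b < k ∧ k < a := by
  have ha0 : 0 < a := hb.trans hba
  have h1a : 0 < 1 - a := by linarith
  have h1b : 0 < 1 - b := by linarith
  have key {x y : ℝ} (hx : 0 < x) (hy : 0 < y) (hxy : x ≠ y) :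
      y * (Real.log x - Real.log y) < x - y := by
    have hlog := Real.log_lt_sub_one_of_pos (div_pos hx hy) (by
      rwa [Ne, div_eq_one_iff_eq hy.ne'])
    rw [Real.log_div hx.ne' hy.ne'] at hlog
    calc y * (Real.log x - Real.log y) < y * (x / y - 1) := by gcongr
      _ = x - y := by field_simp
  have hlog := congrArg Real.log h
  rw [Real.log_mul (Real.rpow_pos_of_pos (by positivity) _).ne'
      (Real.rpow_pos_of_pos (by positivity) _).ne',
    Real.log_rpow (by positivity), Real.log_rpow (by positivity),
    Real.log_div ha0.ne' hb.ne', Real.log_div h1a.ne' h1b.ne', Real.log_one] at hlog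
  have h1 := key ha0 hb hba.ne'
  have h2 := key h1a h1b (by linarith)
  have h3 := key hb ha0 hba.ne
  have h4 := key h1b h1a (by linarith)
  have hU := Real.log_lt_log hb hba
  have hV := Real.log_lt_log h1a (sub_lt_sub_left hba 1)
  constructor <;> nlinarith

/-- If `phi` equals one at `t`, then the weight `k` lies strictly between the probabilities of
success before `t` in the two states. -/
theorem mem_Ioo_of_phi_eq_one {lam ρH ρL k t : ℝ} (hlam : 0 < lam) (hρL : 0 < ρL) (hρ : ρL < ρH)
    (hρH : ρH < 1) (ht : 0 < t) (h : phi ρH ρL lam k t = 1) :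
    ρL * (1 - Real.exp (-lam * t)) < k ∧ k < ρH * (1 - Real.exp (-lam * t)) := by
  have hx : 0 < 1 - Real.exp (-lam * t) := by
    rw [sub_pos, Real.exp_lt_one_iff]
    nlinarith
  have hx1 : 1 - Real.exp (-lam * t) < 1 := by linarith [Real.exp_pos (-lam * t)]
  refine mem_Ioo_of_rpow_mul_rpow_eq_one (by positivity) (by gcongr) (by nlinarith) ?_
  rwa [mul_div_mul_right _ _ hx.ne']

/-- Proposition 3, limit vote-share form: with
k* = (ρ_H g − s)/(g − s) and the limit cut-off t̂_k = t̂'_k for k < k̄ and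
t̂_k = t̄ for k ≥ k̄, we have (i) k̄ < k* < 1; (ii) for k ∈ (0, k*),
ρ_H(1 − e^{−λt̂_k}) > k > ρ_L(1 − e^{−λt̂_k}); (iii) for k ∈ [k*, 1],
ρ_H(1 − e^{−λt̂_k}) ≤ k and ρ_L(1 − e^{−λt̂_k}) < k. -/
theorem information_aggregation_limit
    (lam ρH ρL s g : ℝ) (hlam : 0 < lam)
    (hρL : 0 < ρL) (hρ : ρL < ρH) (hρH : ρH < 1)
    (hs : 0 < s) (hg : 0 < g) (hgs : ρH * g > s) (hsg : s > ρL * g)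
    (tbar : ℝ) (htbar : 0 < tbar ∧ Pst ρH lam tbar = s / g)
    (tprime : ℝ → ℝ)
    (htprime : ∀ k, 0 < k → k < khat ρH ρL →
      0 < tprime k ∧ phi ρH ρL lam k (tprime k) = 1)
    (kbar : ℝ)
    (hkbar : (0 < kbar ∧ kbar < khat ρH ρL) ∧ phi ρH ρL lam kbar tbar = 1)
    (kstar : ℝ) (hkstar : kstar = (ρH * g - s) / (g - s))
    (tcut : ℝ → ℝ)
    (htcut : ∀ k, tcut k = if k < kbar then tprime k else tbar) :
    (kbar < kstar ∧ kstar < 1) ∧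
    (∀ k, 0 < k → k < kstar →
      ρL * (1 - Real.exp (-lam * tcut k)) < k ∧
      k < ρH * (1 - Real.exp (-lam * tcut k))) ∧
    (∀ k, kstar ≤ k → k ≤ 1 →
      ρH * (1 - Real.exp (-lam * tcut k)) ≤ k ∧
      ρL * (1 - Real.exp (-lam * tcut k)) < k) := by
  obtain ⟨ht0, hP⟩ := htbar
  obtain ⟨⟨hk0, hkhat⟩, hphi⟩ := hkbar
  have hgs' : 0 < g - s := by nlinarith
  obtain ⟨hlow, hupp⟩ := mem_Ioo_of_phi_eq_one hlam hρL hρ hρH ht0 hphi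
  have hstar : ρH * (1 - Real.exp (-lam * tbar)) = kstar := by
    have hden : 0 < ρH * Real.exp (-lam * tbar) + 1 - ρH := by
      have := mul_pos (hρL.trans hρ) (Real.exp_pos (-lam * tbar))
      linarith
    rw [Pst, div_eq_div_iff hden.ne' hg.ne'] at hP
    rw [hkstar, eq_div_iff hgs'.ne']
    linarith
  rw [hstar] at hupp
  refine ⟨⟨hupp, ?_⟩, fun k hk hks => ?_, fun k hks _ => ?_⟩
  · rw [hkstar, div_lt_one hgs']
    nlinarith
  · rw [htcut]
    split_ifs with hlt
    · obtain ⟨ht, hphi'⟩ := htprime k hk (hlt.trans hkhat)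
      exact mem_Ioo_of_phi_eq_one hlam hρL hρ hρH ht hphi'
    · exact ⟨by linarith, by linarith⟩
  · rw [htcut, if_neg (by linarith)]
    exact ⟨by linarith, by linarith⟩
end

section
/- (Failure of information aggregation under unanimity.) There is no sequence (x_N)_{N≥1} with x_N ∈ [0,1] for all N such that (1 − ρ_H·x_N)^N → 0 and (1 − ρ_L·x_N)^N → 1 as N → ∞. -/
open Real Filter

/-- On `[0, 1]`, a fixed power of `1 - b * x` lies below `1 - a * x`. -/
lemma exists_one_sub_mul_pow_le {a b : ℝ} (ha0 : 0 < a) (ha1 : a < 1) (hb0 : 0 < b)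
    (hb1 : b ≤ 1) :
    ∃ k : ℕ, ∀ x ∈ Set.Icc (0 : ℝ) 1, (1 - b * x) ^ k ≤ 1 - a * x := by
  obtain ⟨k, hk⟩ := exists_nat_ge (a / ((1 - a) * b))
  refine ⟨k, fun x ⟨hx0, hx1⟩ => ?_⟩
  have ha : 0 < 1 - a := by linarith
  rw [div_le_iff₀ (by positivity)] at hk
  have hax : 0 < 1 - a * x := by nlinarith
  have hbx : 0 ≤ 1 - b * x := by nlinarith
  have hkb : (0 : ℝ) ≤ k * b * x := by positivity
  have hlower : 1 ≤ (1 - a * x) * (1 + k * b * x) := by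
    have h₁ : a * x ≤ k * ((1 - a) * b) * x := by gcongr
    have h₂ : (1 - a) * (k * b * x) ≤ (1 - a * x) * (k * b * x) := by
      gcongr
      nlinarith
    linarith
  have hexp : (1 - b * x) ^ k ≤ exp (-(k * b * x)) := by
    calc (1 - b * x) ^ k ≤ exp (-(b * x)) ^ k := by
          gcongr
          exact one_sub_le_exp_neg _
      _ = exp (-(k * b * x)) := by
          rw [← exp_nat_mul]
          congr 1
          ring
  refine hexp.trans ?_
  rw [exp_neg, inv_le_iff_one_le_mul₀ (exp_pos _)]
  refine hlower.trans ?_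
  gcongr
  linarith [add_one_le_exp (k * b * x)]

/-- failure of information aggregation under unanimity: there is
no sequence (x_N) in [0,1] with (1 − ρ_H x_N)^N → 0 and (1 − ρ_L x_N)^N → 1. -/
theorem no_aggregation_under_unanimity
    (ρH ρL : ℝ) (hρL : 0 < ρL) (hρ : ρL < ρH) (hρH : ρH < 1) :
    ¬ ∃ x : ℕ → ℝ, (∀ N, 1 ≤ N → x N ∈ Set.Icc (0 : ℝ) 1) ∧
      Tendsto (fun N : ℕ => (1 - ρH * x N) ^ N) atTop (nhds 0) ∧
      Tendsto (fun N : ℕ => (1 - ρL * x N) ^ N) atTop (nhds 1) := by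
  rintro ⟨x, hx, hH, hL⟩
  obtain ⟨k, hk⟩ := exists_one_sub_mul_pow_le (hρL.trans hρ) hρH hρL (hρ.trans hρH).le
  have hLk : Tendsto (fun N : ℕ => ((1 - ρL * x N) ^ N) ^ k) atTop (nhds 1) := by
    simpa using hL.pow k
  have hle : (1 : ℝ) ≤ 0 := by
    refine le_of_tendsto_of_tendsto hLk hH ?_
    filter_upwards [eventually_ge_atTop 1] with N hN
    obtain ⟨hx0, hx1⟩ := hx N hN
    have hbase : 0 ≤ 1 - ρL * x N := by nlinarith
    rw [pow_right_comm]
    exact pow_le_pow_left₀ (pow_nonneg hbase k) (hk _ ⟨hx0, hx1⟩) N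
  linarith
end
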